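/- Let D ⊆ {0,1}^n, let f : D → {0,1} be a nonconstant partial Boolean function, let T be a decision tree, let r ≥ 1, let 𝒟_f be the canonical hard distribution for f, and let x = (x^{(1)},…,x^{(r)}) ∈ f⁻¹(1)^r. Let π be the restriction given by the path followed by x in T, and assume Sens(f^{⊕r}_π, x) ≠ ∅. Then the conditional probability that f^{⊕r}(z) ≠ T(z), where z ∼ 𝒟_f^{⊗r} conditioned on (x^{(1)},…,x^{(r)}) being the tuple of 1-inputs sampled in the first step of each of the r independent experiments, is at least 2^{−r} · Π_{i=1}^r max{1, |Sens(f_{π^{(i)}}, x^{(i)})|} / max{1, |Sens(f, x^{(i)})|}, where π^{(i)} is the part of π touching the i-th block of variables and f_{π^{(i)}} is the restriction of the i-th copy of f by π^{(i)}. -/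

import Mathlib

open Finset

attribute [local instance] Classical.propDecidable

/-- A binary decision tree querying coordinates of type `ι`. -/
inductive DTree (ι : Type) : Type where
  | leaf : Bool → DTree ι
  | node : ι → DTree ι → DTree ι → DTree ι

namespace DTree

/-- Evaluation of a decision tree on an input. -/
def eval {ι : Type} : DTree ι → (ι → Bool) → Bool
  | .leaf b, _ => b
  | .node i t0 t1, x => if x i then t1.eval x else t0.eval x

/-- The size of a decision tree is its number of leaves. -/
def size {ι : Type} : DTree ι → ℕ
  | .leaf _ => 1
  | .node _ t0 t1 => t0.size + t1.size

/-- The restriction (set of literals) given by the root-to-leaf path followed by `x` in `T`. -/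
noncomputable def pathRes {ι : Type} : DTree ι → (ι → Bool) → (ι → Option Bool)
  | .leaf _, _ => fun _ => none
  | .node i t0 t1, x =>
      Function.update (if x i then t1.pathRes x else t0.pathRes x) i (some (x i))

end DTree

/-- Apply a restriction to an input: coordinates fixed by `ρ` take their fixed value. -/
def override {ι : Type} (ρ : ι → Option Bool) (x : ι → Bool) : ι → Bool :=
  fun i => (ρ i).getD (x i)

/-- The number of literals in a restriction. -/
noncomputable def resSize {ι : Type} [Fintype ι] (ρ : ι → Option Bool) : ℕ :=
  (Finset.univ.filter fun i => (ρ i).isSome).card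

/-- A restriction `ρ` is consistent with the input `x`. -/
def Consistent {ι : Type} (ρ : ι → Option Bool) (x : ι → Bool) : Prop :=
  ∀ i b, ρ i = some b → x i = b

/-- `T` computes the partial function (represented by the total function `f`) on domain `D`. -/
def Computes {ι : Type} (T : DTree ι) (f : (ι → Bool) → Bool) (D : Finset (ι → Bool)) : Prop :=
  ∀ x ∈ D, T.eval x = f x

/-- `DT(f)`: the minimal size of a decision tree computing the partial function `f : D → {0,1}`. -/
noncomputable def DTsize {ι : Type} (f : (ι → Bool) → Bool) (D : Finset (ι → Bool)) : ℕ :=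
  sInf {s | ∃ T : DTree ι, Computes T f D ∧ T.size = s}

/-- The domain of the subfunction `f_ρ`: inputs whose `ρ`-override lies in `D`. -/
noncomputable def restrictD {ι : Type} [Fintype ι] (D : Finset (ι → Bool)) (ρ : ι → Option Bool) :
    Finset (ι → Bool) :=
  Finset.univ.filter fun x => override ρ x ∈ D

/-- The subfunction `f_ρ` of `f` obtained by fixing variables according to `ρ`. -/
def restrictF {ι : Type} (f : (ι → Bool) → Bool) (ρ : ι → Option Bool) : (ι → Bool) → Bool :=
  fun x => f (override ρ x)

/-- The partial function `f : D → {0,1}` is constant on its domain. -/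
def IsConstOn {ι : Type} (f : (ι → Bool) → Bool) (D : Finset (ι → Bool)) : Prop :=
  ∀ x ∈ D, ∀ y ∈ D, f x = f y

/-- `Cert(f, x)`: the minimal number of literals of a restriction `ρ` consistent with `x`
such that `f_ρ` is constant on its domain. -/
noncomputable def Cert {ι : Type} [Fintype ι] (f : (ι → Bool) → Bool) (D : Finset (ι → Bool))
    (x : ι → Bool) : ℕ :=
  sInf {k | ∃ ρ : ι → Option Bool, Consistent ρ x ∧
    IsConstOn (restrictF f ρ) (restrictD D ρ) ∧ resSize ρ = k}

/-- `x` with bit `i` flipped. -/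
noncomputable def flipBit {ι : Type} (x : ι → Bool) (i : ι) : ι → Bool :=
  Function.update x i (!(x i))

/-- `Sens(f, x)`: the set of sensitive neighbors of `x` that lie in the domain `D`. -/
noncomputable def sensSet {ι : Type} [Fintype ι] (f : (ι → Bool) → Bool) (D : Finset (ι → Bool))
    (x : ι → Bool) : Finset (ι → Bool) :=
  D.filter fun y => (∃ i, y = flipBit x i) ∧ f y ≠ f x

/-- `Sens(f)`: the maximum sensitivity of the partial function `f : D → {0,1}`. -/
noncomputable def maxSens {ι : Type} [Fintype ι] (f : (ι → Bool) → Bool)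
    (D : Finset (ι → Bool)) : ℕ :=
  D.sup fun x => (sensSet f D x).card

/-- `error_𝒟(T, f) = Pr_{x ∼ 𝒟}[T(x) ≠ f(x)]`, for a distribution given by its
probability mass function `𝒟`. -/
noncomputable def errD {ι : Type} [Fintype ι] (𝒟 : (ι → Bool) → ℝ) (T : DTree ι)
    (f : (ι → Bool) → Bool) : ℝ :=
  ∑ x : ι → Bool, 𝒟 x * (if T.eval x = f x then 0 else 1)

/-- XOR of a finite family of bits. -/
noncomputable def xorAll {r : ℕ} (g : Fin r → Bool) : Bool :=
  decide (Odd (Finset.univ.filter fun i => g i = true).card)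

/-- Combine a tuple of `r` inputs into a single input on `r` disjoint blocks of `n` variables. -/
def glue {n r : ℕ} (x : Fin r → (Fin n → Bool)) : Fin r × Fin n → Bool :=
  fun p => x p.1 p.2

/-- `f^{⊕r}`: the `r`-fold XOR of `f`, as a function on `r` disjoint blocks of `n` variables. -/
noncomputable def xorFun (r : ℕ) {n : ℕ} (f : (Fin n → Bool) → Bool) :
    (Fin r × Fin n → Bool) → Bool :=
  fun z => xorAll fun i => f fun j => z (i, j)

/-- `D^r`: the domain of `f^{⊕r}`. -/
noncomputable def prodDom (r : ℕ) {n : ℕ} (D : Finset (Fin n → Bool)) :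
    Finset (Fin r × Fin n → Bool) :=
  Finset.univ.filter fun z => ∀ i : Fin r, (fun j => z (i, j)) ∈ D

/-- The part of a restriction touching the `i`-th block of variables. -/
def blockRes {n r : ℕ} (ρ : Fin r × Fin n → Option Bool) (i : Fin r) : Fin n → Option Bool :=
  fun j => ρ (i, j)

/-- The probability mass function of the canonical hard distribution `𝒟_f` conditioned on the
`1`-input `x` sampled in the first step of the experiment: the output is `x` with probability
`1/2`, and a uniformly random sensitive neighbor of `x` with probability `1/2`. -/
noncomputable def condW {ι : Type} [Fintype ι] (f : (ι → Bool) → Bool) (D : Finset (ι → Bool))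
    (x y : ι → Bool) : ℝ :=
  (if y = x then 1 / 2 else 0) +
  (if y ∈ sensSet f D x then (1 / 2) / max 1 ((sensSet f D x).card : ℝ) else 0)

/-- The probability that `T(z) ≠ f^{⊕r}(z)` where `z ∼ 𝒟_f^{⊗r}` conditioned on
`(x⁽¹⁾, …, x⁽ʳ⁾)` being the tuple of `1`-inputs sampled in the first steps of the `r`
independent experiments. -/
noncomputable def condErrR {n r : ℕ} (T : DTree (Fin r × Fin n)) (f : (Fin n → Bool) → Bool)
    (D : Finset (Fin n → Bool)) (x : Fin r → (Fin n → Bool)) : ℝ :=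
  ∑ z : Fin r → (Fin n → Bool),
    (∏ i, condW f D (x i) (z i)) * (if T.eval (glue z) = xorFun r f (glue z) then 0 else 1)

theorem DTree.pathRes_consistent {ι : Type} (T : DTree ι) (x : ι → Bool) :
    Consistent (T.pathRes x) x := by
  induction T with
  | leaf b => intro i b h; simp [DTree.pathRes] at h
  | node k t0 t1 h0 h1 =>
    intro i b h
    rw [DTree.pathRes] at h
    by_cases hik : i = k
    · subst hik
      simpa using h
    · rw [Function.update_of_ne hik] at h
      split_ifs at h
      exacts [h1 i b h, h0 i b h]

/-- An input agreeing with `x` on the variables queried by `T` on `x` reaches the same leaf. -/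
theorem DTree.eval_eq_of_pathRes {ι : Type} (T : DTree ι) {x z : ι → Bool}
    (h : ∀ i, T.pathRes x i ≠ none → z i = x i) : T.eval z = T.eval x := by
  induction T with
  | leaf b => rfl
  | node k t0 t1 h0 h1 =>
    have hk : z k = x k := h k (by simp [DTree.pathRes])
    have key : ∀ i, (if x k then t1.pathRes x else t0.pathRes x) i ≠ none → z i = x i := by
      intro i hi
      by_cases hik : i = k
      · rw [hik, hk]
      · exact h i (by rwa [DTree.pathRes, Function.update_of_ne hik])
    simp only [DTree.eval, hk]
    split_ifs with hxk
    · exact h1 (by simpa [hxk] using key)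
    · exact h0 (by simpa [hxk] using key)

theorem override_eq_self {ι : Type} {ρ : ι → Option Bool} {x : ι → Bool} (h : Consistent ρ x) :
    override ρ x = x := by
  funext i
  cases hi : ρ i with
  | none => simp [override, hi]
  | some b => simp [override, hi, h i b hi]

theorem ne_of_mem_sensSet {ι : Type} [Fintype ι] {f : (ι → Bool) → Bool}
    {D : Finset (ι → Bool)} {x y : ι → Bool} (hy : y ∈ sensSet f D x) : f y ≠ f x := by
  simp only [sensSet, mem_filter] at hy
  exact hy.2.2

theorem self_notMem_sensSet {ι : Type} [Fintype ι] (f : (ι → Bool) → Bool)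
    (D : Finset (ι → Bool)) (x : ι → Bool) : x ∉ sensSet f D x := by
  simp [sensSet]

/-- A sensitive neighbor of `x` for `f_ρ` agrees with `x` on the variables fixed by `ρ`. -/
theorem eq_of_mem_sensSet_restrict {ι : Type} [Fintype ι] {f : (ι → Bool) → Bool}
    {D : Finset (ι → Bool)} {ρ : ι → Option Bool} {x y : ι → Bool}
    (hy : y ∈ sensSet (restrictF f ρ) (restrictD D ρ) x) {i : ι} (hi : ρ i ≠ none) :
    y i = x i := by
  simp only [sensSet, mem_filter] at hy
  obtain ⟨-, ⟨k, rfl⟩, hne⟩ := hy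
  by_cases hik : i = k
  · subst hik
    refine absurd (congrArg f (funext fun l => ?_)) hne
    by_cases hl : l = i
    · subst hl
      obtain ⟨b, hb⟩ := Option.ne_none_iff_exists'.1 hi
      simp [override, hb]
    · simp [override, flipBit, Function.update_of_ne hl]
  · simp [flipBit, Function.update_of_ne hik]

theorem sensSet_restrict_subset {ι : Type} [Fintype ι] {f : (ι → Bool) → Bool}
    {D : Finset (ι → Bool)} {ρ : ι → Option Bool} {x : ι → Bool} (hρ : Consistent ρ x) :
    sensSet (restrictF f ρ) (restrictD D ρ) x ⊆ sensSet f D x := by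
  intro y hy
  have hyρ : override ρ y = y := override_eq_self fun i b hb => by
    rw [eq_of_mem_sensSet_restrict hy (by simp [hb])]
    exact hρ i b hb
  simp only [sensSet, restrictD, restrictF, mem_filter, mem_univ, true_and, hyρ,
    override_eq_self hρ] at hy ⊢
  exact hy

theorem xorAll_ne_of_ne_at {r : ℕ} {g h : Fin r → Bool} {i : Fin r} (hi : g i ≠ h i)
    (hoff : ∀ k, k ≠ i → g k = h k) : xorAll g ≠ xorAll h := by
  have split : ∀ u : Fin r → Bool, (univ.filter fun k => u k = true).card =
      (if u i = true then 1 else 0) + ∑ k ∈ univ.erase i, if u k = true then 1 else 0 := by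
    intro u
    rw [card_filter, add_sum_erase _ (fun k => if u k = true then 1 else 0) (mem_univ i)]
  have hs : (∑ k ∈ univ.erase i, if g k = true then 1 else 0) =
      ∑ k ∈ univ.erase i, if h k = true then 1 else 0 :=
    sum_congr rfl fun k hk => by rw [hoff k (ne_of_mem_erase hk)]
  unfold xorAll
  rw [split g, split h, hs]
  cases hg : g i <;> cases hh : h i <;> simp_all [Nat.odd_add]
  all_goals rw [← Nat.not_odd_iff_even]; tauto

theorem condW_nonneg {ι : Type} [Fintype ι] (f : (ι → Bool) → Bool) (D : Finset (ι → Bool))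
    (x y : ι → Bool) : 0 ≤ condW f D x y := by
  unfold condW
  positivity

theorem condW_self {ι : Type} [Fintype ι] (f : (ι → Bool) → Bool) (D : Finset (ι → Bool))
    (x : ι → Bool) : condW f D x x = 1 / 2 := by
  simp [condW, self_notMem_sensSet]

theorem condW_of_mem {ι : Type} [Fintype ι] {f : (ι → Bool) → Bool} {D : Finset (ι → Bool)}
    {x y : ι → Bool} (hy : y ∈ sensSet f D x) :
    condW f D x y = 1 / 2 / max 1 ((sensSet f D x).card : ℝ) := by
  have : y ≠ x := fun h => self_notMem_sensSet f D x (h ▸ hy)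
  simp [condW, hy, this]

/-- The conditional error is at least the mass of any product set of inputs on which `T` errs. -/
theorem prod_sum_condW_le_condErrR {n r : ℕ} {T : DTree (Fin r × Fin n)}
    {f : (Fin n → Bool) → Bool} {D : Finset (Fin n → Bool)} {x : Fin r → (Fin n → Bool)}
    (t : Fin r → Finset (Fin n → Bool))
    (ht : ∀ z, (∀ i, z i ∈ t i) → T.eval (glue z) ≠ xorFun r f (glue z)) :
    ∏ i, ∑ y ∈ t i, condW f D (x i) y ≤ condErrR T f D x := by
  rw [prod_univ_sum, condErrR]
  calc ∑ z ∈ Fintype.piFinset t, ∏ i, condW f D (x i) (z i)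
      = ∑ z ∈ Fintype.piFinset t, (∏ i, condW f D (x i) (z i)) *
          (if T.eval (glue z) = xorFun r f (glue z) then 0 else 1) :=
        sum_congr rfl fun z hz => by
          rw [if_neg (ht z (Fintype.mem_piFinset.1 hz)), mul_one]
    _ ≤ _ := sum_le_sum_of_subset_of_nonneg (subset_univ _) fun z _ _ =>
        mul_nonneg (prod_nonneg fun i _ => condW_nonneg f D _ _) (by split_ifs <;> norm_num)

/-- A sensitive neighbor for `f^{⊕r}_ρ` yields a block in which the restricted copy of `f` has a
sensitive neighbor. -/
theorem exists_block_sensSet_nonempty {n r : ℕ} {f : (Fin n → Bool) → Bool}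
    {D : Finset (Fin n → Bool)} {ρ : Fin r × Fin n → Option Bool} {x : Fin r → (Fin n → Bool)}
    (h : (sensSet (restrictF (xorFun r f) ρ) (restrictD (prodDom r D) ρ) (glue x)).Nonempty) :
    ∃ i, (sensSet (restrictF f (blockRes ρ i)) (restrictD D (blockRes ρ i)) (x i)).Nonempty := by
  obtain ⟨w, hw⟩ := h
  simp only [sensSet, restrictD, prodDom, mem_filter, mem_univ, true_and] at hw
  obtain ⟨hD, ⟨⟨i, j⟩, rfl⟩, hne⟩ := hw
  refine ⟨i, fun l => flipBit (glue x) (i, j) (i, l), ?_⟩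
  simp only [sensSet, restrictD, mem_filter, mem_univ, true_and]
  refine ⟨hD i, ⟨j, ?_⟩, fun heq => hne ?_⟩
  · funext l
    by_cases hl : l = j
    · subst hl
      simp [flipBit, glue]
    · simp [flipBit, glue, hl]
  · refine congrArg xorAll (funext fun k => ?_)
    by_cases hk : k = i
    · subst hk
      exact heq
    · refine congrArg f (funext fun l => ?_)
      simp [override, flipBit, hk]

/-- error of `f^{⊕r}` conditioned on a tuple of `1`-inputs. -/
theorem stmt6 {n : ℕ} (D : Finset (Fin n → Bool)) (f : (Fin n → Bool) → Bool)
    (hnc : ∃ x ∈ D, ∃ y ∈ D, f x ≠ f y) (r : ℕ) (hr : 1 ≤ r)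
    (T : DTree (Fin r × Fin n)) (x : Fin r → (Fin n → Bool))
    (hx : ∀ i, x i ∈ D ∧ f (x i) = true)
    (hsens : (sensSet (restrictF (xorFun r f) (T.pathRes (glue x)))
        (restrictD (prodDom r D) (T.pathRes (glue x))) (glue x)).Nonempty) :
    ((1 : ℝ) / 2) ^ r *
        ∏ i, (max 1 ((sensSet (restrictF f (blockRes (T.pathRes (glue x)) i))
                (restrictD D (blockRes (T.pathRes (glue x)) i)) (x i)).card : ℝ)) /
              (max 1 ((sensSet f D (x i)).card : ℝ))
      ≤ condErrR T f D x := by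
  set π := T.pathRes (glue x)
  have hcons : ∀ i, Consistent (blockRes π i) (x i) := fun i j b hb =>
    T.pathRes_consistent (glue x) (i, j) b hb
  have hsub := fun i => sensSet_restrict_subset (f := f) (D := D) (hcons i)
  have hq : ∀ i, 1 / 2 * ((max 1 ((sensSet (restrictF f (blockRes π i))
      (restrictD D (blockRes π i)) (x i)).card : ℝ)) / (max 1 ((sensSet f D (x i)).card : ℝ)))
      ≤ ∑ y ∈ {x i}, condW f D (x i) y := by
    intro i
    rw [sum_singleton, condW_self]
    refine mul_le_of_le_one_right (by norm_num) (div_le_one_of_le₀ ?_ (by positivity))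
    exact max_le_max_left _ (by exact_mod_cast card_le_card (hsub i))
  have hconst : ((1 : ℝ) / 2) ^ r = ∏ _i : Fin r, (1 / 2 : ℝ) := by simp
  rw [hconst, ← prod_mul_distrib]
  by_cases hT : T.eval (glue x) = xorFun r f (glue x)
  · obtain ⟨i₀, hne⟩ := exists_block_sensSet_nonempty hsens
    set S := sensSet (restrictF f (blockRes π i₀)) (restrictD D (blockRes π i₀)) (x i₀) with hS
    let t : Fin r → Finset (Fin n → Bool) := Function.update (fun i => {x i}) i₀ S
    refine le_trans (prod_le_prod (fun i _ => by positivity) fun i _ => ?_)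
      (prod_sum_condW_le_condErrR t fun z hz => ?_)
    · by_cases hi : i = i₀
      · subst hi
        have h1 : (1 : ℝ) ≤ S.card := by exact_mod_cast hne.card_pos
        rw [← hS, show t i = S from Function.update_self ..,
          sum_congr rfl fun y hy => condW_of_mem (hsub i hy), sum_const, nsmul_eq_mul,
          max_eq_right h1]
        exact le_of_eq (by ring)
      · rw [show t i = {x i} from Function.update_of_ne hi ..]
        exact hq i
    · have hz₀ : z i₀ ∈ S := by simpa [t] using hz i₀
      have hz₁ : ∀ i, i ≠ i₀ → z i = x i := fun i hi => by
        simpa [t, Function.update_of_ne hi] using hz i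
      have heval : T.eval (glue z) = T.eval (glue x) := by
        refine T.eval_eq_of_pathRes fun ⟨i, j⟩ hp => ?_
        by_cases hi : i = i₀
        · subst hi
          exact eq_of_mem_sensSet_restrict hz₀ hp
        · simp [glue, hz₁ i hi]
      rw [heval, hT]
      refine xorAll_ne_of_ne_at (i := i₀) ?_ fun k hk => ?_
      · exact (ne_of_mem_sensSet (hsub i₀ hz₀)).symm
      · exact congrArg f (hz₁ k hk).symm
  · refine le_trans (prod_le_prod (fun i _ => by positivity) fun i _ => hq i)
      (prod_sum_condW_le_condErrR (fun i => {x i}) fun z hz => ?_)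
    have : z = x := funext fun i => by simpa using hz i
    rwa [this]
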